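/- arXiv:0909.0340 — 2 statements merged into one kernel-verified Lean document; each statement's English description precedes it below -/
import Mathlib

section
/- Let m ≥ 0 be an integer, let B be an orthonormal basis (with respect to the differential pairing) of Harm_{2m} ⊂ ℝ[x₁,…,xₙ], and let v, w ∈ ℝⁿ be nonzero vectors with c := ⟨v,w⟩/(‖v‖·‖w‖) the cosine of the angle between them. Then Σ_{h∈B} h(v)·h(w) = p_m(c) · ‖v‖^{2m} · ‖w‖^{2m}. -/
noncomputable section

open MvPolynomial MeasureTheory Finset
open scoped RealInnerProductSpace Manifold

namespace Heat

abbrev Poly (n : ℕ) := MvPolynomial (Fin n) ℝ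
abbrev E (n : ℕ) := EuclideanSpace ℝ (Fin n)

variable (n : ℕ)

/-- The differential operator `∂^I` on polynomials. -/
def pdI (I : Fin n →₀ ℕ) : Poly n → Poly n :=
  (List.ofFn fun i : Fin n => (fun p : Poly n => (⇑(pderiv i))^[I i] p)).foldr (· ∘ ·) id

/-- The differential pairing `⟨g, f⟩ = (g(∂)f)(0)`. -/
def dPair (g f : Poly n) : ℝ :=
  eval 0 (∑ I ∈ g.support, g.coeff I • pdI n I f)

/-- The Laplacian `Δ = -∑ ∂ᵢ²` as a linear map on polynomials. -/
def lap : Poly n →ₗ[ℝ] Poly n :=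
  -∑ i : Fin n, ((pderiv i : Derivation ℝ (Poly n) (Poly n)).toLinearMap ∘ₗ
    (pderiv i : Derivation ℝ (Poly n) (Poly n)).toLinearMap)

/-- `r² = ∑ xᵢ²`. -/
def rsq : Poly n := ∑ i : Fin n, X i ^ 2

/-- Harmonic homogeneous polynomials of degree `m`. -/
def Harm (m : ℕ) : Submodule ℝ (Poly n) :=
  homogeneousSubmodule (Fin n) ℝ m ⊓ LinearMap.ker (lap n)

/-- `B` is an orthonormal basis of the subspace `S` w.r.t. the differential pairing. -/
structure IsONBasis (S : Submodule ℝ (Poly n)) (B : Finset (Poly n)) : Prop where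
  mem : ∀ h ∈ B, h ∈ S
  ortho : ∀ h ∈ B, ∀ g ∈ B, dPair n h g = if h = g then 1 else 0
  span : Submodule.span ℝ (B : Set (Poly n)) = S

/-- Evaluation of a polynomial at a point of Euclidean space. -/
def peval (f : Poly n) (x : E n) : ℝ := eval (fun i => x i) f

/-- `μ` is the rotation-invariant probability measure on the unit sphere `S^{n-1}`. -/
structure IsSphereMeasure (μ : Measure (E n)) : Prop where
  prob : IsProbabilityMeasure μ
  supp : μ (Metric.sphere (0 : E n) 1)ᶜ = 0
  inv : ∀ φ : E n ≃ₗᵢ[ℝ] E n, Measure.map φ μ = μ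

/-- The lattice spanned (over `ℤ`) by the vectors `b`. -/
def latticeOf (b : Fin n → E n) : Submodule ℤ (E n) := Submodule.span ℤ (Set.range b)

/-- An integral lattice: all square norms are integers. -/
def IsIntegral (L : Submodule ℤ (E n)) : Prop := ∀ v ∈ L, ∃ z : ℤ, ‖v‖ ^ 2 = (z : ℝ)

/-- The matrix `A` with `½A` the Gram matrix of the basis `b`. -/
def evenGram (b : Fin n → E n) : Matrix (Fin n) (Fin n) ℝ :=
  Matrix.of fun i j => 2 * ⟪b i, b j⟫

/-- A real matrix has integer entries and even diagonal. -/
def IntEvenDiag (M : Matrix (Fin n) (Fin n) ℝ) : Prop :=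
  (∀ i j, ∃ z : ℤ, M i j = (z : ℝ)) ∧ ∀ i, ∃ z : ℤ, M i i = 2 * (z : ℝ)

/-- `N` is the level of the lattice with basis `b`. -/
def IsLevel (b : Fin n → E n) (N : ℕ) : Prop :=
  0 < N ∧ IntEvenDiag n ((N : ℝ) • (evenGram n b)⁻¹) ∧
    ∀ M : ℕ, 0 < M → IntEvenDiag n ((M : ℝ) • (evenGram n b)⁻¹) → N ≤ M

/-- The spherical theta function `Θ_{h,Λ}`. -/
def theta (h : Poly n) (L : Submodule ℤ (E n)) (τ : UpperHalfPlane) : ℂ :=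
  ∑' v : L, (peval n h (v : E n) : ℂ) *
    Complex.exp (2 * (Real.pi : ℂ) * Complex.I * ((‖(v : E n)‖ ^ 2 : ℝ) : ℂ) * (τ : ℂ))

/-- The image of the lattice `L` under an isometry of Euclidean space. -/
def mapLat (φ : E n ≃ₗᵢ[ℝ] E n) (L : Submodule ℤ (E n)) : Submodule ℤ (E n) :=
  L.map (φ.toLinearEquiv.toLinearMap.restrictScalars ℤ)

/-- The Kronecker symbol at 2, `(a/2)`. -/
def kronAtTwo (a : ℤ) : ℤ :=
  if a % 2 = 0 then 0 else if a % 8 = 1 ∨ a % 8 = 7 then 1 else -1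

/-- The Kronecker symbol `(a/m)`. -/
def kronSym (a m : ℤ) : ℤ :=
  if m = 0 then (if a = 1 ∨ a = -1 then 1 else 0)
  else
    (if m < 0 ∧ a < 0 then -1 else 1) *
      kronAtTwo a ^ (m.natAbs.factorization 2) *
      jacobiSym a (m.natAbs / 2 ^ (m.natAbs.factorization 2))

open UpperHalfPlane in
/-- `f` is a modular form of weight `w`, level `N` and character `χ`:  it is holomorphic
on the upper half plane, transforms under `Γ₀(N)` with automorphy factor `χ(d)(cτ+d)^w`,
and is bounded towards all cusps. -/
structure IsModularForm (N : ℕ) (w : ℝ) (χ : ℤ → ℤ) (f : UpperHalfPlane → ℂ) : Prop where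
  holo : MDifferentiable 𝓘(ℂ) 𝓘(ℂ) f
  transf : ∀ γ : Matrix.SpecialLinearGroup (Fin 2) ℤ, γ ∈ CongruenceSubgroup.Gamma0 N →
    ∀ τ : UpperHalfPlane, f (γ • τ) =
      ((χ ((γ : Matrix (Fin 2) (Fin 2) ℤ) 1 1) : ℝ) : ℂ) *
      (((((γ : Matrix (Fin 2) (Fin 2) ℤ) 1 0 : ℤ) : ℂ)) * (τ : ℂ) +
        (((γ : Matrix (Fin 2) (Fin 2) ℤ) 1 1 : ℤ) : ℂ)) ^ (w : ℂ) * f τ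
  bdd : ∀ γ : Matrix.SpecialLinearGroup (Fin 2) ℤ,
    IsBoundedAtImInfty fun τ : UpperHalfPlane =>
      (((((γ : Matrix (Fin 2) (Fin 2) ℤ) 1 0 : ℤ) : ℂ)) * (τ : ℂ) +
        (((γ : Matrix (Fin 2) (Fin 2) ℤ) 1 1 : ℤ) : ℂ)) ^ (-(w : ℂ)) * f (γ • τ)

/-- The trivial character. -/
def trivChar : ℤ → ℤ := fun _ => 1

open scoped Classical in
/-- The multiple theta series `Θ_{m₁,…,m_k,Λ}` attached to a family of bases `B i`. -/
def thetaMulti (k : ℕ) (B : Fin k → Finset (Poly n)) (L : Submodule ℤ (E n))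
    (μ : Measure (E n)) (τ : UpperHalfPlane) : ℂ :=
  ∑ g ∈ Fintype.piFinset B,
    (∏ i, theta n (g i) L τ) * (((∫ x, ∏ i, peval n (g i) x ∂μ) : ℝ) : ℂ)

/-- The polynomial `p_m` (evaluated at `c`). -/
def pmVal (m : ℕ) (c : ℝ) : ℝ :=
  ∑ k ∈ Finset.range (m + 1),
    (-1 : ℝ) ^ k * c ^ (2 * m - 2 * k) /
      ((Nat.factorial (2 * m - 2 * k) : ℝ) * (Nat.factorial k : ℝ) * 2 ^ k *
        ∏ l ∈ Finset.range k, ((n : ℝ) + 4 * m - 4 - 2 * l))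

/-- The heat flux `f_Λ` of the lattice `L`. -/
def heatF (L : Submodule ℤ (E n)) (t : ℝ) (x : E n) : ℝ :=
  (4 * Real.pi * t) ^ (-(n : ℝ) / 2) * ∑' γ : L, Real.exp (-‖x - (γ : E n)‖ ^ 2 / (4 * t))

/-- Partial derivative of a function on Euclidean space. -/
def pdFun (i : Fin n) (F : E n → ℝ) : E n → ℝ := fun x => fderiv ℝ F x (EuclideanSpace.single i 1)

/-- Iterated partial derivative `∂^I` of a function on Euclidean space. -/
def pdIFun (I : Fin n →₀ ℕ) : (E n → ℝ) → (E n → ℝ) :=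
  (List.ofFn fun i : Fin n => (fun F : E n → ℝ => (pdFun n i)^[I i] F)).foldr (· ∘ ·) id

/-- The differential operator `g(∂)` applied to a smooth function. -/
def applyDiff (g : Poly n) (F : E n → ℝ) (x : E n) : ℝ :=
  ∑ I ∈ g.support, g.coeff I * pdIFun n I F x

open scoped Classical in
/-- The degree `2m` homogeneous term of the Taylor expansion of `x ↦ f_Λ(t,x)` at `0`. -/
def taylorTerm (L : Submodule ℤ (E n)) (m : ℕ) (t : ℝ) : Poly n :=
  ∑ c ∈ (Fintype.piFinset fun _ : Fin n => Finset.range (2 * m + 1)).filter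
      (fun c => ∑ i, c i = 2 * m),
    (pdIFun n (Finsupp.equivFunOnFinite.symm c) (heatF n L t) 0 /
      ∏ i, (Nat.factorial (c i) : ℝ)) • ∏ i, X i ^ c i

/-- `P` is the orthogonal projection of `A_m` onto `Harm_m` w.r.t. the differential
pairing: on `A_m` it takes values in `Harm_m`, `f - P f` is orthogonal to `Harm_m`,
and it is the identity on `Harm_m`. -/
def IsHarmProj (m : ℕ) (P : Poly n → Poly n) : Prop :=
  (∀ f ∈ homogeneousSubmodule (Fin n) ℝ m, P f ∈ Harm n m ∧
    ∀ h ∈ Harm n m, dPair n h (f - P f) = 0) ∧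
  ∀ h ∈ Harm n m, P h = h

/-- The `E₈` lattice as a subset of `ℝ⁸`. -/
def E8set : Set (E 8) :=
  {x | ((∀ i, ∃ z : ℤ, x i = (z : ℝ)) ∨ (∀ i, ∃ z : ℤ, x i = (z : ℝ) + 1 / 2)) ∧
    ∃ z : ℤ, (∑ i, x i) = 2 * (z : ℝ)}

end Heat

namespace Heat

variable (n : ℕ)

/-- The operator `P_{harm,m} = ∑_{k=0}^{⌊m/2⌋} r_{k,m} · r^{2k} Δ^k` on polynomials. -/
def PharmOp (m : ℕ) : Poly n → Poly n := fun f =>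
  ∑ k ∈ Finset.range (m / 2 + 1),
    (1 / ((2 : ℝ) ^ k * (Nat.factorial k : ℝ) *
      ∏ l ∈ Finset.range k, ((n : ℝ) + 2 * (m : ℝ) - 4 - 2 * (l : ℝ)))) •
      (rsq n ^ k * ((lap n ^ k) f))

/-- The quantity `Ξ(u,v,w)`. -/
def Xi (u v w : E n) : ℝ :=
  2 * ‖u‖ ^ 2 * ‖v‖ ^ 2 * ‖w‖ ^ 2 -
    (n : ℝ) * (‖u‖ ^ 2 * ⟪v, w⟫ ^ 2 + ‖v‖ ^ 2 * ⟪u, w⟫ ^ 2 + ‖w‖ ^ 2 * ⟪u, v⟫ ^ 2) +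
    (n : ℝ) ^ 2 * ⟪v, w⟫ * ⟪u, w⟫ * ⟪u, v⟫

/-- The `k`-th coefficient of the claimed q-expansion of `Θ_{m,m,Λ}`. -/
def mmCoeff (m : ℕ) (L : Submodule ℤ (E n)) (k : ℕ) : ℝ :=
  ∑' p : {p : L × L // (p.1 : E n) ≠ 0 ∧ (p.2 : E n) ≠ 0 ∧
      ‖(p.1 : E n)‖ ^ 2 + ‖(p.2 : E n)‖ ^ 2 = (k : ℝ)},
    pmVal n m (⟪(p.1.1 : E n), (p.1.2 : E n)⟫ / (‖(p.1.1 : E n)‖ * ‖(p.1.2 : E n)‖)) *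
      ‖(p.1.1 : E n)‖ ^ (2 * m) * ‖(p.1.2 : E n)‖ ^ (2 * m)

/-- The sum `∑ Ξ(u,v,w)` over lattice triples of total square norm `k`. -/
def tripleCoeff (L : Submodule ℤ (E n)) (k : ℕ) : ℝ :=
  ∑' t : {t : L × L × L //
      ‖(t.1 : E n)‖ ^ 2 + ‖(t.2.1 : E n)‖ ^ 2 + ‖(t.2.2 : E n)‖ ^ 2 = (k : ℝ)},
    Xi n (t.1.1 : E n) (t.1.2.1 : E n) (t.1.2.2 : E n)

/-- The generalized binomial coefficient `C(z,k) = z(z-1)⋯(z-k+1)/k!`. -/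
def genBinom (z : ℝ) (k : ℕ) : ℝ :=
  (∏ a ∈ Finset.range k, (z - (a : ℝ))) / (Nat.factorial k : ℝ)

open scoped Classical in
/-- The monomial orthonormal basis `{xᵢ²/√2} ∪ {xᵢxⱼ, i<j}` of `A₂`. -/
def B2 : Finset (Poly n) :=
  (Finset.univ.image fun i : Fin n => (Real.sqrt 2)⁻¹ • (X i ^ 2 : Poly n)) ∪
  ((Finset.univ.filter fun p : Fin n × Fin n => p.1 < p.2).image
    fun p => (X p.1 * X p.2 : Poly n))

/-- The explicit harmonic projection in degree two, `P = id + (1/(2n)) r² Δ`. -/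
def P2 : Poly n → Poly n := fun g => g + (1 / (2 * (n : ℝ))) • (rsq n * lap n g)

end Heat
namespace Heat

/-- The factorial weight of a multi-index. -/
def wt (n : ℕ) (I : Fin n →₀ ℕ) : ℝ := ∏ i, (Nat.factorial (I i) : ℝ)

lemma coeff_iter_pderiv {n : ℕ} (i : Fin n) (k : ℕ) (p : Poly n) (J : Fin n →₀ ℕ) :
    coeff J ((⇑(pderiv i : Derivation ℝ (Poly n) (Poly n)))^[k] p) =
      coeff (J + Finsupp.single i k) p * ((J i + 1).ascFactorial k : ℝ) := by
  induction k generalizing p with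
  | zero => simp
  | succ k ih =>
    rw [Function.iterate_succ_apply, ih, coeff_pderiv, Nat.ascFactorial_succ, add_assoc,
      ← Finsupp.single_add]
    simp
    ring

lemma coeff_foldr {n : ℕ} (I : Fin n →₀ ℕ) (L : List (Fin n)) (hL : L.Nodup) (p : Poly n)
    (J : Fin n →₀ ℕ) (hJ : ∀ i ∈ L, J i = 0) :
    coeff J ((L.map fun i : Fin n => (fun p : Poly n =>
      (⇑(pderiv i : Derivation ℝ (Poly n) (Poly n)))^[I i] p)).foldr (· ∘ ·) id p) =
      coeff (J + (L.map fun i => Finsupp.single i (I i)).sum) p *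
        (L.map fun i => (Nat.factorial (I i) : ℝ)).prod := by
  induction L generalizing J with
  | nil => simp
  | cons a L ih =>
    rw [List.nodup_cons] at hL
    simp only [List.map_cons, List.foldr_cons, Function.comp_apply, List.sum_cons, List.prod_cons]
    rw [coeff_iter_pderiv, ih hL.2]
    · rw [hJ a (by simp), add_assoc]
      simp only [zero_add, Nat.one_ascFactorial]
      ring
    · intro i hi
      have : a ≠ i := by rintro rfl; exact hL.1 hi
      simp [hJ i (by simp [hi]), this]

lemma eval_pdI {n : ℕ} (I : Fin n →₀ ℕ) (f : Poly n) :
    eval 0 (pdI n I f) = coeff I f * wt n I := by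
  have h0 : eval (0 : Fin n → ℝ) (pdI n I f) = coeff 0 (pdI n I f) := by
    rw [← constantCoeff_eq]
    simp
  rw [h0, pdI, List.ofFn_eq_map, coeff_foldr I _ (List.nodup_finRange n) f 0 (by simp), wt]
  have h1 : (List.map (fun i => Finsupp.single i (I i)) (List.finRange n)).sum = I := by
    rw [← List.ofFn_eq_map, List.sum_ofFn]
    exact Finsupp.univ_sum_single I
  have h2 : (List.map (fun i => (Nat.factorial (I i) : ℝ)) (List.finRange n)).prod
      = ∏ i, (Nat.factorial (I i) : ℝ) := by
    rw [← List.ofFn_eq_map, List.prod_ofFn]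
  rw [h1, h2, zero_add]

lemma dPair_eq {n : ℕ} (g f : Poly n) :
    dPair n g f = ∑ I ∈ g.support, coeff I g * (coeff I f * wt n I) := by
  rw [dPair, map_sum]
  refine Finset.sum_congr rfl fun I _ => ?_
  rw [smul_eval, eval_pdI]

lemma dPair_add {n : ℕ} (g f f' : Poly n) :
    dPair n g (f + f') = dPair n g f + dPair n g f' := by
  simp [dPair_eq, ← Finset.sum_add_distrib]
  exact Finset.sum_congr rfl fun _ _ => by ring

lemma dPair_smul {n : ℕ} (g f : Poly n) (c : ℝ) :
    dPair n g (c • f) = c * dPair n g f := by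
  simp [dPair_eq, Finset.mul_sum]
  exact Finset.sum_congr rfl fun _ _ => by ring

/-- The pairing as a linear map in the second variable. -/
def dL {n : ℕ} (g : Poly n) : Poly n →ₗ[ℝ] ℝ where
  toFun := dPair n g
  map_add' := dPair_add g
  map_smul' c f := dPair_smul g f c

lemma dL_monomial {n : ℕ} (g : Poly n) (J : Fin n →₀ ℕ) (b : ℝ) :
    dL g (monomial J b) = coeff J g * b * wt n J := by
  classical
  change dPair n g _ = _
  rw [dPair_eq]
  simp only [coeff_monomial]
  rw [Finset.sum_eq_single J]
  · simp; ring
  · intro I _ h; simp [h.symm]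
  · intro h; simp [MvPolynomial.notMem_support_iff.1 h]

lemma dL_add_left {n : ℕ} (g g' : Poly n) : dL (g + g') = dL g + dL g' := by
  refine LinearMap.ext fun f => ?_
  induction f using MvPolynomial.induction_on' with
  | monomial J b => simp [dL_monomial]; ring
  | add p q hp hq => rw [map_add, hp, hq, map_add]

lemma dL_zero_left {n : ℕ} : dL (0 : Poly n) = 0 := by
  have := dL_add_left (0 : Poly n) 0
  simpa using this

lemma dL_sum_left {n : ℕ} {ι : Type*} (s : Finset ι) (g : ι → Poly n) :
    dL (∑ i ∈ s, g i) = ∑ i ∈ s, dL (g i) :=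
  map_sum (AddMonoidHom.mk' (dL (n := n)) dL_add_left) g s

lemma wt_add_single {n : ℕ} (J : Fin n →₀ ℕ) (i : Fin n) :
    wt n (J + Finsupp.single i 1) = (J i + 1) * wt n J := by
  classical
  unfold wt
  rw [← Finset.mul_prod_erase univ _ (Finset.mem_univ i),
    ← Finset.mul_prod_erase univ (fun j => (Nat.factorial (J j) : ℝ)) (Finset.mem_univ i)]
  have : ∀ j ∈ univ.erase i, (Nat.factorial ((J + Finsupp.single i 1 : Fin n →₀ ℕ) j) : ℝ)
      = Nat.factorial (J j) := by
    intro j hj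
    have : i ≠ j := (Finset.ne_of_mem_erase hj).symm
    simp [this]
  rw [Finset.prod_congr rfl this]
  simp [Nat.factorial_succ]
  ring

lemma dL_X_mul {n : ℕ} (g f : Poly n) (i : Fin n) :
    dL g (X i * f) = dL (pderiv i g) f := by
  induction f using MvPolynomial.induction_on' with
  | monomial J b =>
    rw [X, monomial_mul, dL_monomial, dL_monomial, coeff_pderiv, one_mul, add_comm _ J,
      wt_add_single]
    ring
  | add p q hp hq => rw [mul_add, map_add, hp, hq, map_add]

lemma dL_rsq_mul {n : ℕ} (h : Poly n) (hh : lap n h = 0) (f : Poly n) :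
    dL h (rsq n * f) = 0 := by
  have h1 : dL h (rsq n * f) = dL (∑ i, pderiv i (pderiv i h)) f := by
    rw [rsq, Finset.sum_mul, map_sum, dL_sum_left, LinearMap.sum_apply]
    refine Finset.sum_congr rfl fun i _ => ?_
    rw [pow_two, mul_assoc, dL_X_mul, dL_X_mul]
  have h2 : (∑ i, pderiv i (pderiv i h)) = 0 := by
    simpa [lap, LinearMap.sum_apply] using hh
  rw [h1, h2, dL_zero_left]; rfl

/-- The linear form `x ↦ ⟨w,x⟩`. -/
def lf {n : ℕ} (w : Fin n → ℝ) : Poly n := ∑ i, C (w i) * X i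

lemma lf_hom {n : ℕ} (w : Fin n → ℝ) : (lf w).IsHomogeneous 1 := by
  refine IsHomogeneous.sum _ _ _ fun i _ => ?_
  simpa using (isHomogeneous_C (Fin n) (w i)).mul (isHomogeneous_X ℝ i)

lemma rsq_hom (n : ℕ) : (rsq n).IsHomogeneous 2 := by
  refine IsHomogeneous.sum _ _ _ fun i _ => ?_
  simpa using (isHomogeneous_X ℝ i).pow 2

lemma dL_lf_pow {n : ℕ} (w : Fin n → ℝ) (d : ℕ) (h : Poly n) (hh : h.IsHomogeneous d) :
    dL h (lf w ^ d) = Nat.factorial d * eval w h := by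
  induction d generalizing h with
  | zero =>
    have : h = C (coeff 0 h) := by
      rw [← totalDegree_eq_zero_iff_eq_C]
      exact Nat.le_zero.1 hh.totalDegree_le
    rw [pow_zero, this]
    have := dL_monomial (C (coeff 0 h) : Poly n) 0 1
    simp only [monomial_zero', C_1] at this
    rw [this]
    simp [wt]
  | succ d ih =>
    have e := congrArg (eval w) hh.sum_X_mul_pderiv
    simp only [map_sum, map_mul, eval_X, nsmul_eq_mul, map_natCast] at e
    rw [pow_succ', lf, Finset.sum_mul, map_sum, ← lf]
    have : ∀ i ∈ (univ : Finset (Fin n)), dL h (C (w i) * X i * lf w ^ d) =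
        Nat.factorial d * (w i * eval w (pderiv i h)) := by
      intro i _
      rw [mul_assoc, C_mul', map_smul, dL_X_mul, ih _ (by simpa using hh.pderiv (i := i))]
      simp; ring
    rw [Finset.sum_congr rfl this, ← Finset.mul_sum, e, Nat.factorial_succ]
    push_cast; ring

/-- Positive Laplacian. -/
def L {n : ℕ} (f : Poly n) : Poly n := ∑ i, pderiv i (pderiv i f)

lemma lap_eq {n : ℕ} (f : Poly n) : lap n f = - L f := by
  simp [lap, L, LinearMap.sum_apply]

lemma L_mul {n : ℕ} (f g : Poly n) :
    L (f * g) = L f * g + f * L g + 2 * ∑ i, pderiv i f * pderiv i g := by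
  simp only [L, pderiv_mul, map_add, Finset.sum_add_distrib, Finset.sum_mul, Finset.mul_sum]
  simp only [two_mul, Finset.sum_add_distrib]
  ring

lemma pderiv_lf {n : ℕ} (w : Fin n → ℝ) (i : Fin n) : pderiv i (lf w) = C (w i) := by
  classical
  simp [lf, pderiv_X, Pi.single_apply]

lemma pderiv_rsq {n : ℕ} (i : Fin n) : pderiv i (rsq n) = 2 * X i := by
  classical
  simp [rsq, pderiv_X, Pi.single_apply]

lemma L_lf_pow {n : ℕ} (w : Fin n → ℝ) (a : ℕ) :
    L (lf w ^ (a + 2)) = C ((a + 2) * (a + 1) * ∑ i, w i ^ 2) * lf w ^ a := by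
  simp only [L, pderiv_pow, pderiv_lf, pderiv_mul, pderiv_C]
  simp only [map_mul, map_sum, map_add, map_natCast, map_ofNat, map_one, Finset.mul_sum,
    Finset.sum_mul, map_pow]
  refine Finset.sum_congr rfl fun i _ => ?_
  have : pderiv i (((a + 2 : ℕ) : Poly n)) = 0 := by
    rw [← map_natCast (C : ℝ →+* Poly n), pderiv_C]
  rw [this]
  simp
  ring

lemma C_two {n : ℕ} : (C (2 : ℝ) : Poly n) = 2 := map_ofNat C 2

lemma L_rsq_pow (n k : ℕ) :
    L (rsq n ^ (k + 1)) = C (2 * (k + 1 : ℝ) * (n + 2 * k)) * rsq n ^ k := by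
  have e := ((rsq_hom n).pow k).sum_X_mul_pderiv
  have key : ∀ i, pderiv i (pderiv i (rsq n ^ (k + 1))) =
      C (2 * (k + 1 : ℝ)) * rsq n ^ k + C (2 * (k + 1 : ℝ)) * (X i * pderiv i (rsq n ^ k)) := by
    intro i
    have : pderiv i (rsq n ^ (k + 1)) = C (2 * (k + 1 : ℝ)) * (X i * rsq n ^ k) := by
      rw [pderiv_pow, pderiv_rsq]
      simp [C_two]
      ring
    rw [this, pderiv_C_mul, pderiv_mul, pderiv_X_self]
    ring
  rw [L, Finset.sum_congr rfl fun i _ => key i, Finset.sum_add_distrib, ← Finset.mul_sum,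
    ← Finset.mul_sum, e]
  simp [C_two]
  ring

lemma cross {n : ℕ} (w : Fin n → ℝ) (a k : ℕ) :
    ∑ i, pderiv i (lf w ^ a) * pderiv i (rsq n ^ (k + 1)) =
      C (2 * (k + 1 : ℝ) * a) * (lf w ^ a * rsq n ^ k) := by
  have e := ((lf_hom w).pow a).sum_X_mul_pderiv
  have key : ∀ i, pderiv i (lf w ^ a) * pderiv i (rsq n ^ (k + 1)) =
      (C (2 * (k + 1 : ℝ)) * rsq n ^ k) * (X i * pderiv i (lf w ^ a)) := by
    intro i
    have : pderiv i (rsq n ^ (k + 1)) = C (2 * (k + 1 : ℝ)) * (X i * rsq n ^ k) := by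
      rw [pderiv_pow, pderiv_rsq]
      simp [C_two]
      ring
    rw [this]
    ring
  rw [Finset.sum_congr rfl fun i _ => key i, ← Finset.mul_sum, e]
  simp [C_two]
  ring

lemma L_C_mul {n : ℕ} (c : ℝ) (f : Poly n) : L (C c * f) = C c * L f := by
  simp [L, Finset.mul_sum]

lemma L_add {n : ℕ} (f g : Poly n) : L (f + g) = L f + L g := by
  simp [L, Finset.sum_add_distrib]

lemma L_one {n : ℕ} : L (1 : Poly n) = 0 := by simp [L]

/-- Second-order part produced by the linear form. -/
def F {n : ℕ} (w : Fin n → ℝ) (a k : ℕ) : Poly n := L (lf w ^ a) * rsq n ^ k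

lemma L_term {n : ℕ} (w : Fin n → ℝ) (a k : ℕ) :
    L (lf w ^ a * rsq n ^ (k + 1)) = F w a (k + 1) +
      C (2 * (k + 1 : ℝ) * (n + 2 * k + 2 * a)) * (lf w ^ a * rsq n ^ k) := by
  rw [L_mul, cross, L_rsq_pow, F]
  simp [C_two]
  ring

/-- The coefficients of the zonal polynomial. -/
def bc (n m k : ℕ) (N : ℝ) : ℝ :=
  (-1 : ℝ) ^ k * N ^ k / ((Nat.factorial (2 * m - 2 * k) : ℝ) * (Nat.factorial k : ℝ) * 2 ^ k *
        ∏ l ∈ Finset.range k, ((n : ℝ) + 4 * m - 4 - 2 * l))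

/-- The zonal harmonic. -/
def Kt {n : ℕ} (w : Fin n → ℝ) (m j : ℕ) : Poly n :=
  ∑ k ∈ Finset.range (j + 1), C (bc n m k (∑ i, w i ^ 2)) * (lf w ^ (2 * m - 2 * k) * rsq n ^ k)

lemma L_Kt {n : ℕ} (hn : 0 < n) (w : Fin n → ℝ) (m j : ℕ) (hj : j ≤ m) :
    L (Kt w m j) = C (bc n m j (∑ i, w i ^ 2)) * F w (2 * m - 2 * j) j := by
  induction j with
  | zero => simp [Kt, L_C_mul, F]
  | succ j ih =>
    have hs : Kt w m (j + 1) = Kt w m j + C (bc n m (j + 1) (∑ i, w i ^ 2)) *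
        (lf w ^ (2 * m - 2 * (j + 1)) * rsq n ^ (j + 1)) := Finset.sum_range_succ _ _
    rw [hs, L_add, ih (by omega), L_C_mul, L_term]
    obtain ⟨q, rfl⟩ : ∃ q, m = j + 1 + q := ⟨m - (j + 1), by omega⟩
    have e1 : 2 * (j + 1 + q) - 2 * j = 2 * q + 2 := by omega
    have e2 : 2 * (j + 1 + q) - 2 * (j + 1) = 2 * q := by omega
    rw [e1, e2]
    have hF : F w (2 * q + 2) j =
        C (((2 * q + 2) * (2 * q + 1) * ∑ i, w i ^ 2 : ℝ)) * (lf w ^ (2 * q) * rsq n ^ j) := by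
      rw [F, L_lf_pow]; push_cast; ring
    rw [hF]
    have hb : bc n (j + 1 + q) j (∑ i, w i ^ 2) * ((2 * q + 2) * (2 * q + 1) * ∑ i, w i ^ 2) +
        bc n (j + 1 + q) (j + 1) (∑ i, w i ^ 2) *
          (2 * (j + 1) * (n + 2 * j + 2 * ((2 * q : ℕ) : ℝ))) = 0 := by
      unfold bc
      rw [e1, e2, Finset.prod_range_succ]
      have hP : ∏ l ∈ Finset.range j, ((n : ℝ) + 4 * ((j + 1 + q : ℕ) : ℝ) - 4 - 2 * l) ≠ 0 := by
        refine Finset.prod_ne_zero_iff.2 fun l hl => ?_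
        have h1 : (l : ℝ) + 1 ≤ j := by exact_mod_cast Finset.mem_range.1 hl
        have h2 : (0 : ℝ) < n := by exact_mod_cast hn
        have h3 : (0 : ℝ) ≤ q := Nat.cast_nonneg q
        have h4 : (0 : ℝ) ≤ l := Nat.cast_nonneg l
        push_cast
        apply ne_of_gt
        linarith
      have hx : (n : ℝ) + 4 * ((j + 1 + q : ℕ) : ℝ) - 4 - 2 * j = n + 2 * j + 4 * q := by
        push_cast; ring
      have hy : (n : ℝ) + 2 * j + 4 * q ≠ 0 := by positivity
      rw [hx, Nat.factorial_succ (2 * q + 1), Nat.factorial_succ (2 * q), Nat.factorial_succ j]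
      generalize ∏ l ∈ Finset.range j, ((n : ℝ) + 4 * ((j + 1 + q : ℕ) : ℝ) - 4 - 2 * l) = P at *
      have f1 : (Nat.factorial (2 * q) : ℝ) ≠ 0 := by positivity
      have f2 : (Nat.factorial j : ℝ) ≠ 0 := by positivity
      have f3 : (2 * q + 1 : ℝ) ≠ 0 := by positivity
      have f4 : (2 * q + 1 + 1 : ℝ) ≠ 0 := by positivity
      have f5 : (j + 1 : ℝ) ≠ 0 := by positivity
      push_cast
      field_simp
      ring
    have hb' := congrArg (C : ℝ → Poly n) hb
    rw [C_add, C_mul, C_mul (a := bc n (j + 1 + q) (j + 1) _), C_0] at hb'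
    linear_combination (lf w ^ (2 * q) * rsq n ^ j) * hb'

lemma Kt_mem {n : ℕ} (hn : 0 < n) (w : Fin n → ℝ) (m : ℕ) : Kt w m m ∈ Harm n (2 * m) := by
  refine ⟨?_, ?_⟩
  · change (Kt w m m).IsHomogeneous (2 * m)
    refine IsHomogeneous.sum _ _ _ fun k hk => ?_
    have hk' := Finset.mem_range.1 hk
    have := (isHomogeneous_C (Fin n) (bc n m k (∑ i, w i ^ 2))).mul
      (((lf_hom w).pow (2 * m - 2 * k)).mul ((rsq_hom n).pow k))
    have e : 0 + (1 * (2 * m - 2 * k) + 2 * k) = 2 * m := by omega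
    rwa [e] at this
  · change lap n _ = 0
    rw [lap_eq, L_Kt hn w m m le_rfl]
    simp [F, L_one]

lemma dL_Kt {n : ℕ} (w : Fin n → ℝ) (m : ℕ) (h : Poly n) (hh : h ∈ Harm n (2 * m)) :
    dL h (Kt w m m) = eval w h := by
  have h1 : h.IsHomogeneous (2 * m) := hh.1
  have h2 : lap n h = 0 := hh.2
  rw [Kt, map_sum, Finset.sum_eq_single 0]
  · rw [C_mul', map_smul]
    simp only [mul_zero, Nat.sub_zero, pow_zero, mul_one]
    rw [dL_lf_pow w _ h h1]
    have : (Nat.factorial (2 * m) : ℝ) ≠ 0 := by positivity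
    simp [bc]
    field_simp
  · intro k _ hk
    obtain ⟨k, rfl⟩ := Nat.exists_eq_succ_of_ne_zero hk
    rw [C_mul', map_smul, pow_succ', mul_left_comm, dL_rsq_mul h h2, smul_zero]
  · simp

lemma expand {n : ℕ} {S : Submodule ℝ (Poly n)} {B : Finset (Poly n)} (hB : IsONBasis n S B)
    (f : Poly n) (hf : f ∈ S) : f = ∑ h ∈ B, dL h f • h := by
  rw [← hB.span] at hf
  induction hf using Submodule.span_induction with
  | mem g hg =>
    rw [Finset.sum_eq_single g]
    · have : dL g g = 1 := by
        change dPair n g g = 1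
        rw [hB.ortho g hg g hg]; simp
      rw [this, one_smul]
    · intro b hb hne
      have : dL b g = 0 := by
        change dPair n b g = 0
        rw [hB.ortho b hb g hg]; simp [hne]
      rw [this, zero_smul]
    · intro h; exact absurd hg h
  | zero => simp
  | add x y _ _ hx hy =>
    simp only [map_add, add_smul, Finset.sum_add_distrib]
    rw [← hx, ← hy]
  | smul a x _ hx =>
    simp only [map_smul, smul_eq_mul, mul_smul]
    rw [← Finset.smul_sum, ← hx]

/-- for an orthonormal basis `B` of `Harm_{2m}` and nonzero vectors `v, w`,
`∑_{h∈B} h(v)h(w) = p_m(cos∠(v,w)) ‖v‖^{2m} ‖w‖^{2m}`. -/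
theorem statement5 (n m : ℕ) (hn : 0 < n)
    (B : Finset (Poly n)) (hB : IsONBasis n (Harm n (2 * m)) B)
    (v w : E n) (hv : v ≠ 0) (hw : w ≠ 0) :
    ∑ h ∈ B, peval n h v * peval n h w =
      pmVal n m (⟪v, w⟫ / (‖v‖ * ‖w‖)) * ‖v‖ ^ (2 * m) * ‖w‖ ^ (2 * m) := by
  have h1 := congrArg (eval fun i => v i) (expand hB _ (Kt_mem hn (fun i => w i) m))
  have h2 : ∑ h ∈ B, peval n h v * peval n h w = eval (fun i => v i) (Kt (fun i => w i) m m) := by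
    rw [h1, map_sum]
    refine Finset.sum_congr rfl fun h hh => ?_
    rw [dL_Kt _ _ _ (hB.mem h hh), smul_eval, mul_comm]; rfl
  have hwn : ∑ i, w i ^ 2 = ‖w‖ ^ 2 := by rw [EuclideanSpace.real_norm_sq_eq]
  have hvn : ∑ i, v i ^ 2 = ‖v‖ ^ 2 := by rw [EuclideanSpace.real_norm_sq_eq]
  have hl : eval (fun i => v i) (lf fun i => w i) = ⟪v, w⟫ := by
    simp [lf, PiLp.inner_apply]
  have hr : eval (fun i => v i) (rsq n) = ‖v‖ ^ 2 := by
    simp [rsq, hvn]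
  rw [h2, Kt, map_sum, pmVal, Finset.sum_mul, Finset.sum_mul]
  refine Finset.sum_congr rfl fun k hk => ?_
  have hk' := Finset.mem_range.1 hk
  rw [map_mul, map_mul, map_pow, map_pow, hl, hr, eval_C, hwn, bc]
  obtain ⟨q, rfl⟩ : ∃ q, m = k + q := ⟨m - k, by omega⟩
  have e2 : 2 * (k + q) - 2 * k = 2 * q := by omega
  rw [e2]
  have hv' : ‖v‖ ≠ 0 := norm_ne_zero_iff.2 hv
  have hw' : ‖w‖ ≠ 0 := norm_ne_zero_iff.2 hw
  have hc : (⟪v, w⟫ / (‖v‖ * ‖w‖)) ^ (2 * q) * ‖v‖ ^ (2 * (k + q)) * ‖w‖ ^ (2 * (k + q)) =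
      ⟪v, w⟫ ^ (2 * q) * (‖v‖ ^ 2) ^ k * (‖w‖ ^ 2) ^ k := by
    rw [div_pow, mul_pow, mul_add, pow_add, pow_add, ← pow_mul, ← pow_mul]
    field_simp
  generalize ((Nat.factorial (2 * q) : ℝ) * (Nat.factorial k : ℝ) * 2 ^ k *
        ∏ l ∈ Finset.range k, ((n : ℝ) + 4 * ((k + q : ℕ) : ℝ) - 4 - 2 * l)) = D
  rw [div_mul_eq_mul_div, div_mul_eq_mul_div, div_mul_eq_mul_div]
  congr 1
  linear_combination (-(-1 : ℝ) ^ k) * hc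

end Heat
end
end

section
/- Let u, v, w ∈ ℝⁿ, let B₂ := { x_i²/√2 : 1 ≤ i ≤ n } ∪ { x_i x_j : 1 ≤ i < j ≤ n } be the monomial orthonormal basis of A₂ with respect to the differential pairing, and let P : A₂ → A₂ be the orthogonal projection onto Harm₂ (explicitly P = id + (1/(2n)) r² Δ). Then n³(n+2)(n+4) · Σ_{g₁,g₂,g₃∈B₂} P(g₁)(u) · P(g₂)(v) · P(g₃)(w) · ∫_{S^{n−1}} g₁g₂g₃ dμ̄ = 2‖u‖²‖v‖²‖w‖² − n( ‖u‖²⟨v,w⟩² + ‖v‖²⟨u,w⟩² + ‖w‖²⟨u,v⟩² ) + n²⟨v,w⟩⟨u,w⟩⟨u,v⟩. -/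
noncomputable section

open MvPolynomial MeasureTheory Finset
open scoped RealInnerProductSpace Manifold

namespace Heat


lemma integrable_cont {n : ℕ} {μ : Measure (E n)} (hμ : IsSphereMeasure n μ)
    {f : E n → ℝ} (hf : Continuous f) : Integrable f μ := by
  have := hμ.prob
  have h1 : μ.restrict (Metric.sphere (0 : E n) 1) = μ :=
    Measure.restrict_eq_self_of_ae_mem (by
      rw [ae_iff]; exact hμ.supp)
  rw [← h1]
  exact hf.continuousOn.integrableOn_compact (isCompact_sphere 0 1)

lemma ae_sphere {n : ℕ} {μ : Measure (E n)} (hμ : IsSphereMeasure n μ) :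
    ∀ᵐ x ∂μ, ‖x‖ = 1 := by
  have h : ∀ᵐ x ∂μ, x ∈ Metric.sphere (0 : E n) 1 := by
    rw [ae_iff]; exact hμ.supp
  filter_upwards [h] with x hx
  simpa using hx

lemma F_inv {n : ℕ} {μ : Measure (E n)} (hμ : IsSphereMeasure n μ) (u v : E n)
    (h : ‖u‖ = ‖v‖) : ∫ x, ⟪u, x⟫ ^ 6 ∂μ = ∫ x, ⟪v, x⟫ ^ 6 ∂μ := by
  let φ : E n ≃ₗᵢ[ℝ] E n := (ℝ ∙ (u - v))ᗮ.reflection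
  have hφ : φ u = v := Submodule.reflection_sub h
  have h2 : ∫ x, ⟪v, x⟫ ^ 6 ∂μ = ∫ x, ⟪v, x⟫ ^ 6 ∂(Measure.map φ μ) := by rw [hμ.inv φ]
  rw [h2, integral_map φ.continuous.aemeasurable
    (by apply Continuous.aestronglyMeasurable; fun_prop)]
  simp [← hφ, LinearIsometryEquiv.inner_map_map]

lemma F_eq {n : ℕ} (hn : 0 < n) {μ : Measure (E n)} (hμ : IsSphereMeasure n μ) :
    ∃ c : ℝ, ∀ u : E n, ∫ x, ⟪u, x⟫ ^ 6 ∂μ = c * (‖u‖ ^ 2) ^ 3 := by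
  let e : E n := EuclideanSpace.single ⟨0, hn⟩ 1
  have he : ‖e‖ = 1 := by simp [e]
  refine ⟨∫ x, ⟪e, x⟫ ^ 6 ∂μ, fun u => ?_⟩
  rw [F_inv hμ u (‖u‖ • e) (by simp [norm_smul, he])]
  simp only [real_inner_smul_left, mul_pow]
  rw [integral_const_mul]
  ring

lemma M_eq {n : ℕ} (hn : 0 < n) {μ : Measure (E n)} (hμ : IsSphereMeasure n μ) :
    ∃ c : ℝ, ∀ u v w : E n, ∫ x, ⟪u, x⟫ ^ 2 * ⟪v, x⟫ ^ 2 * ⟪w, x⟫ ^ 2 ∂μ =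
      c * (‖u‖ ^ 2 * ‖v‖ ^ 2 * ‖w‖ ^ 2 + 2 * (‖u‖ ^ 2 * ⟪v, w⟫ ^ 2 + ‖v‖ ^ 2 * ⟪u, w⟫ ^ 2
        + ‖w‖ ^ 2 * ⟪u, v⟫ ^ 2) + 8 * (⟪v, w⟫ * ⟪u, w⟫ * ⟪u, v⟫)) := by
  obtain ⟨c, hc⟩ := F_eq hn hμ
  refine ⟨c / 15, fun u v w => ?_⟩
  have key : ∀ x : E n, ⟪u, x⟫ ^ 2 * ⟪v, x⟫ ^ 2 * ⟪w, x⟫ ^ 2 =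
      (1/360) * ⟪u + v + w, x⟫ ^ 6 + (1/360) * ⟪u + v - w, x⟫ ^ 6
      + (1/360) * ⟪u - v + w, x⟫ ^ 6 + (1/360) * ⟪u - v - w, x⟫ ^ 6
      + (-1/180) * ⟪u + v, x⟫ ^ 6 + (-1/180) * ⟪u - v, x⟫ ^ 6
      + (-1/180) * ⟪u + w, x⟫ ^ 6 + (-1/180) * ⟪u - w, x⟫ ^ 6
      + (-1/180) * ⟪v + w, x⟫ ^ 6 + (-1/180) * ⟪v - w, x⟫ ^ 6
      + (1/90) * ⟪u, x⟫ ^ 6 + (1/90) * ⟪v, x⟫ ^ 6 + (1/90) * ⟪w, x⟫ ^ 6 := by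
    intro x
    simp only [inner_add_left, inner_sub_left]
    ring
  simp only [key]
  iterate 12 rw [integral_add (integrable_cont hμ (by fun_prop)) (integrable_cont hμ (by fun_prop))]
  simp only [integral_const_mul, hc]
  simp only [← real_inner_self_eq_norm_sq, inner_add_left, inner_sub_left, inner_add_right,
    inner_sub_right, real_inner_comm u v, real_inner_comm u w, real_inner_comm v w]
  rw [real_inner_comm v u, real_inner_comm w u, real_inner_comm w v]
  ring

lemma sum_sq_coord {n : ℕ} (x y : E n) : ∑ i, x i * y i = ⟪x, y⟫ := by
  simp [PiLp.inner_apply, mul_comm]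

lemma sum_lt {n : ℕ} (a : Fin n → ℝ) :
    ∑ i, a i ^ 2 / 2 + ∑ p : Fin n × Fin n with p.1 < p.2, a p.1 * a p.2 = (∑ i, a i) ^ 2 / 2 := by
  have h1 : (∑ i, a i) ^ 2 = ∑ p : Fin n × Fin n, a p.1 * a p.2 := by
    rw [sq, Finset.sum_mul_sum, ← Finset.univ_product_univ, Finset.sum_product]
  have h2 : ∑ p : Fin n × Fin n with p.1 < p.2, a p.1 * a p.2 =
      ∑ p : Fin n × Fin n with p.2 < p.1, a p.1 * a p.2 := by
    refine Finset.sum_nbij' Prod.swap Prod.swap ?_ ?_ ?_ ?_ ?_ <;> simp [mul_comm]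
  have h3 : ∑ i, a i ^ 2 = ∑ p : Fin n × Fin n with p.1 = p.2, a p.1 * a p.2 := by
    refine Finset.sum_nbij' (fun i => (i, i)) Prod.fst ?_ ?_ ?_ ?_ ?_ <;> simp [sq]
  have h4 : ∑ p : Fin n × Fin n, a p.1 * a p.2 =
      ∑ p : Fin n × Fin n with p.1 < p.2, a p.1 * a p.2 +
      ∑ p : Fin n × Fin n with p.2 < p.1, a p.1 * a p.2 +
      ∑ p : Fin n × Fin n with p.1 = p.2, a p.1 * a p.2 := by
    simp only [Finset.sum_filter, ← Finset.sum_add_distrib]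
    refine Finset.sum_congr rfl fun p _ => ?_
    rcases lt_trichotomy p.1 p.2 with h | h | h
    · simp [h, h.ne, h.not_gt]
    · simp [h]
    · simp [h, h.ne', h.not_gt]
  rw [← Finset.sum_div]
  linarith

lemma B2_sum {n : ℕ} (f : Poly n → ℝ) : ∑ g ∈ B2 n, f g =
    ∑ i : Fin n, f ((Real.sqrt 2)⁻¹ • (X i ^ 2 : Poly n)) +
    ∑ p : Fin n × Fin n with p.1 < p.2, f (X p.1 * X p.2) := by
  classical
  have hs : (Real.sqrt 2)⁻¹ ≠ 0 := by positivity
  unfold B2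
  rw [Finset.sum_union, Finset.sum_image, Finset.sum_image]
  · rintro ⟨i, j⟩ hp ⟨k, l⟩ hq h
    simp only [coe_filter, mem_univ, true_and, Set.mem_setOf_eq] at hp hq h
    have h' := congrArg MvPolynomial.support h
    rw [← pow_one (X i), ← pow_one (X j), ← pow_one (X k), ← pow_one (X l)] at h'
    simp only [X_pow_eq_monomial, monomial_mul, mul_one] at h'
    rw [support_monomial, support_monomial] at h'
    simp only [one_ne_zero, if_false, Finset.singleton_inj] at h'
    have a1 := DFunLike.congr_fun h' i
    have a2 := DFunLike.congr_fun h' j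
    have a3 := DFunLike.congr_fun h' k
    simp only [Finsupp.add_apply, Finsupp.single_apply] at a1 a2 a3
    have := hp.ne
    have := hq.ne
    ext <;> simp <;> grind
  · intro i _ j _ h
    have h' := congrArg MvPolynomial.support h
    simp only [X_pow_eq_monomial, smul_monomial] at h'
    rw [support_monomial, support_monomial] at h'
    simp only [smul_eq_mul, mul_one, hs, if_false, Finset.singleton_inj] at h'
    have a1 := DFunLike.congr_fun h' i
    simp only [Finsupp.single_apply] at a1
    grind
  · rw [Finset.disjoint_left]
    intro g hg hg'
    simp only [mem_image, mem_univ, true_and, mem_filter] at hg hg'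
    obtain ⟨i, rfl⟩ := hg
    obtain ⟨⟨k, l⟩, hlt, h⟩ := hg'
    have h' := congrArg MvPolynomial.support h
    simp only at h'
    rw [← pow_one (X k), ← pow_one (X l)] at h'
    simp only [X_pow_eq_monomial, monomial_mul, mul_one, smul_monomial] at h'
    rw [support_monomial, support_monomial] at h'
    simp only [smul_eq_mul, mul_one, hs, one_ne_zero, if_false, Finset.singleton_inj] at h'
    have a1 := DFunLike.congr_fun h' k
    have a2 := DFunLike.congr_fun h' l
    simp only [Finsupp.add_apply, Finsupp.single_apply] at a1 a2
    have := hlt.ne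
    grind

lemma lap_sq {n : ℕ} (i : Fin n) : lap n (X i ^ 2) = -2 := by
  simp only [lap, LinearMap.neg_apply, LinearMap.sum_apply, LinearMap.comp_apply,
    Derivation.coeFn_coe]
  rw [Finset.sum_eq_single i]
  · simp [sq, pderiv_X_self]; norm_num
  · intro j _ hj
    simp [sq, pderiv_X_of_ne hj.symm]
  · simp

lemma lap_mul {n : ℕ} (i j : Fin n) (h : i ≠ j) : lap n (X i * X j) = 0 := by
  simp only [lap, LinearMap.neg_apply, LinearMap.sum_apply, LinearMap.comp_apply,
    Derivation.coeFn_coe]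
  rw [Finset.sum_eq_zero, neg_zero]
  intro k _
  by_cases h1 : k = i
  · subst h1
    simp [pderiv_X_of_ne h.symm, pderiv_X_self]
  · by_cases h2 : k = j
    · subst h2
      simp [pderiv_X_of_ne h, pderiv_X_self]
    · simp [pderiv_X_of_ne (Ne.symm h1), pderiv_X_of_ne (Ne.symm h2)]

lemma kernel {n : ℕ} (u x : E n) : ∑ g ∈ B2 n, peval n (P2 n g) u * peval n g x =
    (⟪u, x⟫ ^ 2 - ‖u‖ ^ 2 * ‖x‖ ^ 2 / n) / 2 := by
  have hs : (Real.sqrt 2)⁻¹ * (Real.sqrt 2)⁻¹ = 1 / 2 := by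
    rw [← mul_inv, Real.mul_self_sqrt (by norm_num)]; norm_num
  rw [B2_sum]
  have e1 : ∀ i : Fin n, peval n (P2 n ((Real.sqrt 2)⁻¹ • (X i ^ 2 : Poly n))) u *
      peval n ((Real.sqrt 2)⁻¹ • (X i ^ 2 : Poly n)) x =
      (u i * x i) ^ 2 / 2 - (‖u‖ ^ 2 / (2 * n)) * (x i * x i) := by
    intro i
    simp only [peval, P2, map_smul, lap_sq, rsq]
    simp only [map_add, smul_eval, map_mul, map_sum, map_pow, eval_X, map_neg, map_ofNat]
    rw [← real_inner_self_eq_norm_sq, ← sum_sq_coord]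
    simp only [← sq]
    rw [show ∀ a b s N S : ℝ, (s * a ^ 2 + 1 / (2 * N) * (S * (s * -2))) * (s * b ^ 2)
      = (s * s) * ((a ^ 2 + 1 / (2 * N) * (S * -2)) * b ^ 2) by intros; ring, hs]
    ring
  have e2 : ∀ p ∈ (Finset.univ.filter fun p : Fin n × Fin n => p.1 < p.2),
      peval n (P2 n (X p.1 * X p.2)) u * peval n (X p.1 * X p.2) x =
      (u p.1 * x p.1) * (u p.2 * x p.2) := by
    intro p hp
    simp only [mem_filter, mem_univ, true_and] at hp
    simp only [peval, P2, lap_mul _ _ hp.ne]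
    simp
    ring
  rw [Finset.sum_congr rfl e2, Finset.sum_congr rfl (fun i _ => e1 i), Finset.sum_sub_distrib,
    ← Finset.mul_sum, sum_sq_coord, real_inner_self_eq_norm_sq]
  have := sum_lt (fun i => u i * x i)
  simp only at this
  rw [sum_sq_coord] at this
  linear_combination this


lemma step {n : ℕ} {μ : Measure (E n)} (hμ : IsSphereMeasure n μ) {f : E n → ℝ}
    (hf : Continuous f) :
    ∫ x, f x ∂μ = ∑ k : Fin n, ∫ x, f x * ⟪(EuclideanSpace.single k 1 : E n), x⟫ ^ 2 ∂μ := by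
  rw [← integral_finset_sum _ (fun k _ => integrable_cont hμ (by fun_prop))]
  apply integral_congr_ae
  filter_upwards [ae_sphere hμ] with x hx
  rw [← Finset.mul_sum]
  have : ∑ k : Fin n, ⟪(EuclideanSpace.single k 1 : E n), x⟫ ^ 2 = 1 := by
    have h := sum_sq_coord x x
    rw [real_inner_self_eq_norm_sq, hx] at h
    simp only [EuclideanSpace.inner_single_left]
    simpa [sq] using h
  rw [this, mul_one]

lemma moments {n : ℕ} (hn : 0 < n) {μ : Measure (E n)} (hμ : IsSphereMeasure n μ) :
    ∃ c : ℝ, (∀ u v w : E n, ∫ x, ⟪u, x⟫ ^ 2 * ⟪v, x⟫ ^ 2 * ⟪w, x⟫ ^ 2 ∂μ =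
      c * (‖u‖ ^ 2 * ‖v‖ ^ 2 * ‖w‖ ^ 2 + 2 * (‖u‖ ^ 2 * ⟪v, w⟫ ^ 2 + ‖v‖ ^ 2 * ⟪u, w⟫ ^ 2
        + ‖w‖ ^ 2 * ⟪u, v⟫ ^ 2) + 8 * (⟪v, w⟫ * ⟪u, w⟫ * ⟪u, v⟫))) ∧
      (∀ u v : E n, ∫ x, ⟪u, x⟫ ^ 2 * ⟪v, x⟫ ^ 2 ∂μ =
        c * (n + 4) * (‖u‖ ^ 2 * ‖v‖ ^ 2 + 2 * ⟪u, v⟫ ^ 2)) ∧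
      (∀ u : E n, ∫ x, ⟪u, x⟫ ^ 2 ∂μ = c * (n + 4) * (n + 2) * ‖u‖ ^ 2) ∧
      c * (n + 4) * (n + 2) * n = 1 := by
  obtain ⟨c, hc⟩ := M_eq hn hμ
  have := hμ.prob
  have h2 : ∀ u v : E n, ∫ x, ⟪u, x⟫ ^ 2 * ⟪v, x⟫ ^ 2 ∂μ =
        c * (n + 4) * (‖u‖ ^ 2 * ‖v‖ ^ 2 + 2 * ⟪u, v⟫ ^ 2) := by
    intro u v
    rw [step hμ (by fun_prop)]
    simp only [hc]
    simp only [EuclideanSpace.inner_single_right, EuclideanSpace.norm_single]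
    have a1 := sum_sq_coord u u
    have a2 := sum_sq_coord v v
    have a3 := sum_sq_coord u v
    rw [real_inner_self_eq_norm_sq] at a1 a2
    have e : ∀ k : Fin n, c * (‖u‖ ^ 2 * ‖v‖ ^ 2 * ‖(1:ℝ)‖ ^ 2 +
        2 * (‖u‖ ^ 2 * (1 * (starRingEnd ℝ) (v k)) ^ 2 + ‖v‖ ^ 2 * (1 * (starRingEnd ℝ) (u k)) ^ 2
          + ‖(1:ℝ)‖ ^ 2 * ⟪u, v⟫ ^ 2) +
        8 * (1 * (starRingEnd ℝ) (v k) * (1 * (starRingEnd ℝ) (u k)) * ⟪u, v⟫)) =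
        c * (‖u‖ ^ 2 * ‖v‖ ^ 2 + 2 * ⟪u, v⟫ ^ 2) + (2 * c * ‖u‖ ^ 2) * (v k * v k)
        + (2 * c * ‖v‖ ^ 2) * (u k * u k) + (8 * c * ⟪u, v⟫) * (u k * v k) := by
      intro k
      simp
      ring
    simp only [e, Finset.sum_add_distrib, ← Finset.mul_sum, a1, a2, a3]
    simp
    ring
  have h1 : ∀ u : E n, ∫ x, ⟪u, x⟫ ^ 2 ∂μ = c * (n + 4) * (n + 2) * ‖u‖ ^ 2 := by
    intro u
    rw [step hμ (by fun_prop)]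
    simp only [h2]
    have a1 := sum_sq_coord u u
    rw [real_inner_self_eq_norm_sq] at a1
    simp only [EuclideanSpace.inner_single_right, EuclideanSpace.norm_single]
    have e : ∀ k : Fin n, c * (n + 4) * (‖u‖ ^ 2 * ‖(1:ℝ)‖ ^ 2
        + 2 * (1 * (starRingEnd ℝ) (u k)) ^ 2) =
        c * (n + 4) * ‖u‖ ^ 2 + (2 * c * (n + 4)) * (u k * u k) := by
      intro k
      simp
      ring
    simp only [e, Finset.sum_add_distrib, ← Finset.mul_sum, a1]
    simp
    ring
  refine ⟨c, hc, h2, h1, ?_⟩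
  have h0 := step hμ (f := fun _ => 1) continuous_const
  simp only [one_mul, h1] at h0
  simp at h0
  linear_combination -h0

lemma cont_peval {n : ℕ} (g : Poly n) : Continuous (peval n g) := by
  unfold peval
  exact (MvPolynomial.continuous_eval g).comp (by fun_prop)

/-- computation of
`n³(n+2)(n+4) ∑_{g₁,g₂,g₃∈B₂} P(g₁)(u)P(g₂)(v)P(g₃)(w) ∫ g₁g₂g₃` in terms of norms
and inner products of `u, v, w`. -/
theorem statement9 (n : ℕ) (hn : 0 < n)
    (μ : Measure (E n)) (hμ : IsSphereMeasure n μ)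
    (u v w : E n) :
    (n : ℝ) ^ 3 * ((n : ℝ) + 2) * ((n : ℝ) + 4) *
      ∑ g₁ ∈ B2 n, ∑ g₂ ∈ B2 n, ∑ g₃ ∈ B2 n,
        peval n (P2 n g₁) u * peval n (P2 n g₂) v * peval n (P2 n g₃) w *
          ∫ x, peval n g₁ x * peval n g₂ x * peval n g₃ x ∂μ =
    Xi n u v w := by
  have hc3 : ∀ g₁ g₂ g₃ : Poly n, Integrable
      (fun x => peval n g₁ x * peval n g₂ x * peval n g₃ x) μ := fun g₁ g₂ g₃ =>
    integrable_cont hμ (((cont_peval g₁).mul (cont_peval g₂)).mul (cont_peval g₃))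
  have hsum : ∑ g₁ ∈ B2 n, ∑ g₂ ∈ B2 n, ∑ g₃ ∈ B2 n,
        peval n (P2 n g₁) u * peval n (P2 n g₂) v * peval n (P2 n g₃) w *
          ∫ x, peval n g₁ x * peval n g₂ x * peval n g₃ x ∂μ =
      ∫ x, (∑ g ∈ B2 n, peval n (P2 n g) u * peval n g x) *
        (∑ g ∈ B2 n, peval n (P2 n g) v * peval n g x) *
        (∑ g ∈ B2 n, peval n (P2 n g) w * peval n g x) ∂μ := by
    have e : ∀ x : E n, (∑ g ∈ B2 n, peval n (P2 n g) u * peval n g x) *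
        (∑ g ∈ B2 n, peval n (P2 n g) v * peval n g x) *
        (∑ g ∈ B2 n, peval n (P2 n g) w * peval n g x) =
        ∑ g₁ ∈ B2 n, ∑ g₂ ∈ B2 n, ∑ g₃ ∈ B2 n,
        peval n (P2 n g₁) u * peval n (P2 n g₂) v * peval n (P2 n g₃) w *
          (peval n g₁ x * peval n g₂ x * peval n g₃ x) := by
      intro x
      rw [Finset.sum_mul_sum, Finset.sum_mul]
      refine Finset.sum_congr rfl fun g₁ _ => ?_
      rw [Finset.sum_mul_sum]
      refine Finset.sum_congr rfl fun g₂ _ => Finset.sum_congr rfl fun g₃ _ => ?_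
      ring
    simp only [e]
    rw [integral_finset_sum _ fun g₁ _ => integrable_finset_sum _ fun g₂ _ =>
      integrable_finset_sum _ fun g₃ _ => (hc3 g₁ g₂ g₃).const_mul _]
    refine Finset.sum_congr rfl fun g₁ _ => ?_
    rw [integral_finset_sum _ fun g₂ _ =>
      integrable_finset_sum _ fun g₃ _ => (hc3 g₁ g₂ g₃).const_mul _]
    refine Finset.sum_congr rfl fun g₂ _ => ?_
    rw [integral_finset_sum _ fun g₃ _ => (hc3 g₁ g₂ g₃).const_mul _]
    refine Finset.sum_congr rfl fun g₃ _ => ?_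
    rw [integral_const_mul]
  rw [hsum]
  simp only [kernel]
  obtain ⟨c, m3, m2, m1, m0⟩ := moments hn hμ
  have hp := hμ.prob
  have hn' : (n : ℝ) ≠ 0 := by positivity
  have hI : ∫ x, (⟪u, x⟫ ^ 2 - ‖u‖ ^ 2 * ‖x‖ ^ 2 / n) / 2 *
      ((⟪v, x⟫ ^ 2 - ‖v‖ ^ 2 * ‖x‖ ^ 2 / n) / 2) *
      ((⟪w, x⟫ ^ 2 - ‖w‖ ^ 2 * ‖x‖ ^ 2 / n) / 2) ∂μ =
      ∫ x, ((1/8) * (⟪u, x⟫ ^ 2 * ⟪v, x⟫ ^ 2 * ⟪w, x⟫ ^ 2)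
        + (-‖w‖ ^ 2 / (8 * n)) * (⟪u, x⟫ ^ 2 * ⟪v, x⟫ ^ 2)
        + (-‖v‖ ^ 2 / (8 * n)) * (⟪u, x⟫ ^ 2 * ⟪w, x⟫ ^ 2)
        + (-‖u‖ ^ 2 / (8 * n)) * (⟪v, x⟫ ^ 2 * ⟪w, x⟫ ^ 2)
        + (‖v‖ ^ 2 * ‖w‖ ^ 2 / (8 * n ^ 2)) * ⟪u, x⟫ ^ 2
        + (‖u‖ ^ 2 * ‖w‖ ^ 2 / (8 * n ^ 2)) * ⟪v, x⟫ ^ 2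
        + (‖u‖ ^ 2 * ‖v‖ ^ 2 / (8 * n ^ 2)) * ⟪w, x⟫ ^ 2
        + (-(‖u‖ ^ 2 * ‖v‖ ^ 2 * ‖w‖ ^ 2) / (8 * n ^ 3))) ∂μ := by
    apply integral_congr_ae
    filter_upwards [ae_sphere hμ] with x hx
    simp only [hx]
    field_simp
    ring
  rw [hI]
  iterate 7 rw [integral_add (integrable_cont hμ (by fun_prop)) (integrable_cont hμ (by fun_prop))]
  simp only [integral_const_mul, m3, m2, m1]
  simp only [integral_const, probReal_univ, one_smul]
  have hcv : c = 1 / ((n + 4) * (n + 2) * n) := by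
    field_simp
    linear_combination m0
  rw [hcv, Xi]
  field_simp
  ring

end Heat
end
end
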